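/- Let (J₁, J₂) be a linear generalized Kähler structure on 𝕍 = V × V* with G = −J₁∘J₂, and let K ⊆ V* be an m-dimensional subspace satisfying, for j = 1, 2: (1) K + J_j(K) ⊆ Ann(K + J_j(K)); (2) J_j(K) ∩ V* = {0}; and (3) a(J₁(K)) ∩ a(J₂(K)) = {0}. Let K' ⊆ J₁(K) + J₂(K) be an isotropic subspace with dim K' = m, set N' = a(K') and W_K = Ann(K + J₁(K) + J₂(K) + G(K)). Then N' ⊆ Ann_V(K), the projection a maps W_K into Ann_V(K), the induced linear map a_{K'} : W_K → Ann_V(K)/N' is surjective, and its kernel is a maximal isotropic subspace of W_K for the (nondegenerate) restricted pairing, of dimension dim Ann_{V*}(N') − dim K; hence the exact sequence 0 → Ann_{V*}(N')/K → W_K → Ann_V(K)/N' → 0 is self-dual. (Lemma dual:linear.) -/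

import Mathlib

/-- The generalized tangent space `𝕍 = V × V*`. -/
abbrev GV (V : Type*) [AddCommGroup V] [Module ℝ V] := V × Module.Dual ℝ V

variable (V : Type*) [AddCommGroup V] [Module ℝ V] [FiniteDimensional ℝ V]

/-- The canonical symmetric pairing `⟨(X,ξ),(Y,η)⟩ = (1/2)(η X + ξ Y)` on `𝕍`. -/
noncomputable def pairForm : LinearMap.BilinForm ℝ (GV V) :=
  LinearMap.mk₂ ℝ (fun u v => (1 / 2 : ℝ) * (v.2 u.1 + u.2 v.1))
    (fun u u' v => by simp; ring)
    (fun c u v => by simp; ring)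
    (fun u v v' => by simp; ring)
    (fun c u v => by simp; ring)

/-- `V* = {0} × V*` as a subspace of `𝕍`. -/
def VStar : Submodule ℝ (GV V) := LinearMap.range (LinearMap.inr ℝ V (Module.Dual ℝ V))

variable {V}

/-- The annihilator of a subspace of `𝕍` with respect to the canonical pairing. -/
noncomputable def Ann (S : Submodule ℝ (GV V)) : Submodule ℝ (GV V) where
  carrier := {u : GV V | ∀ s ∈ S, pairForm V u s = 0}
  add_mem' := fun ha hb s hs => by simp [ha s hs, hb s hs]
  zero_mem' := fun s hs => by simp
  smul_mem' := fun c a ha s hs => by simp [ha s hs]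

/-- The image in `𝕍` of a subspace `K ⊆ V*`. -/
def ofDual (K : Submodule ℝ (Module.Dual ℝ V)) : Submodule ℝ (GV V) :=
  K.map (LinearMap.inr ℝ V (Module.Dual ℝ V))

/-- A linear generalized complex structure on `𝕍`. -/
structure IsGenCx (J : GV V →ₗ[ℝ] GV V) : Prop where
  sq : ∀ u, J (J u) = -u
  orth : ∀ u v, pairForm V (J u) (J v) = pairForm V u v

/-- A linear generalized Kähler structure on `𝕍`: two commuting linear generalized
complex structures such that `G = -J₁∘J₂` gives a positive definite form `⟨G·,·⟩`. -/
structure IsGenKahler (J₁ J₂ : GV V →ₗ[ℝ] GV V) : Prop where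
  cx1 : IsGenCx J₁
  cx2 : IsGenCx J₂
  comm : ∀ u, J₁ (J₂ u) = J₂ (J₁ u)
  posdef : ∀ u : GV V, u ≠ 0 → 0 < pairForm V (-(J₁ (J₂ u))) u

theorem pairForm_apply {V : Type*} [AddCommGroup V] [Module ℝ V] (u v : GV V) :
    pairForm V u v = (1 / 2 : ℝ) * (v.2 u.1 + u.2 v.1) := rfl

theorem pairForm_comm {V : Type*} [AddCommGroup V] [Module ℝ V] (u v : GV V) :
    pairForm V u v = pairForm V v u := by
  rw [pairForm_apply, pairForm_apply, add_comm]

theorem mem_ann {V : Type*} [AddCommGroup V] [Module ℝ V]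
    {S : Submodule ℝ (GV V)} {u : GV V} :
    u ∈ Ann S ↔ ∀ s ∈ S, pairForm V u s = 0 := Iff.rfl

theorem mem_ann_sup {V : Type*} [AddCommGroup V] [Module ℝ V]
    {S T : Submodule ℝ (GV V)} {u : GV V} :
    u ∈ Ann (S ⊔ T) ↔ u ∈ Ann S ∧ u ∈ Ann T := by
  refine ⟨fun hu => ⟨fun s hs => hu s (Submodule.mem_sup_left hs),
    fun s hs => hu s (Submodule.mem_sup_right hs)⟩, fun ⟨hS, hT⟩ x hx => ?_⟩
  obtain ⟨s, hs, t, ht, rfl⟩ := Submodule.mem_sup.1 hx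
  rw [map_add, hS s hs, hT t ht, add_zero]

/-- If `G` is an involution making `⟨G·,·⟩` positive definite and `S` is `G`-stable, then
`𝕍` is the direct sum of `S` and its annihilator. -/
theorem isCompl_ann {V : Type*} [AddCommGroup V] [Module ℝ V] [FiniteDimensional ℝ V]
    {G : GV V →ₗ[ℝ] GV V} (hpos : ∀ u, u ≠ 0 → 0 < pairForm V (G u) u)
    {S : Submodule ℝ (GV V)} (hS : S.map G ≤ S) : IsCompl S (Ann S) := by
  have hrefl : (pairForm V).IsRefl := fun u v huv => by rw [pairForm_comm, huv]
  have hAnn : Ann S = (pairForm V).orthogonal S := by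
    ext u
    rw [mem_ann, LinearMap.BilinForm.mem_orthogonal_iff]
    exact forall₂_congr fun s _ => by rw [pairForm_comm]
  have hdisj : Disjoint S (Ann S) := by
    rw [Submodule.disjoint_def]
    intro u hu hu'
    by_contra hne
    have := hpos u hne
    rw [pairForm_comm, hu' _ (hS (Submodule.mem_map_of_mem hu))] at this
    exact lt_irrefl _ this
  rw [hAnn] at hdisj ⊢
  exact (LinearMap.BilinForm.isCompl_orthogonal_iff_disjoint hrefl).2 hdisj

/-- An isotropic `L` is maximal isotropic in `L + G(L)`: the annihilator of `L` is the sum of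
`L` and the annihilator of `L + G(L)`. -/
theorem exists_add_of_mem_ann {V : Type*} [AddCommGroup V] [Module ℝ V]
    [FiniteDimensional ℝ V] {G : GV V →ₗ[ℝ] GV V}
    (hpos : ∀ u, u ≠ 0 → 0 < pairForm V (G u) u) (hG : ∀ u, G (G u) = u)
    {L : Submodule ℝ (GV V)} (hL : L ≤ Ann L) {u : GV V} (hu : u ∈ Ann L) :
    ∃ w ∈ Ann (L ⊔ L.map G), ∃ l ∈ L, w + l = u := by
  have hS : (L ⊔ L.map G).map G ≤ L ⊔ L.map G := by
    rw [Submodule.map_sup]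
    refine sup_le le_sup_right (le_sup_of_le_left ?_)
    rintro _ ⟨_, ⟨x, hx, rfl⟩, rfl⟩
    rwa [hG]
  have htop : u ∈ (L ⊔ L.map G) ⊔ Ann (L ⊔ L.map G) := by
    rw [(isCompl_ann hpos hS).sup_eq_top]; trivial
  obtain ⟨s, hs, w, hw, rfl⟩ := Submodule.mem_sup.1 htop
  obtain ⟨l, hl, _, ⟨l', hl', rfl⟩, rfl⟩ := Submodule.mem_sup.1 hs
  have h0 : pairForm V (G l') l' = 0 := by
    have := hu l' hl'
    rwa [map_add, map_add, LinearMap.add_apply, LinearMap.add_apply, hL hl l' hl',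
      hw l' (Submodule.mem_sup_left hl'), zero_add, add_zero] at this
  have hl0 : l' = 0 := by
    by_contra hne
    exact (hpos l' hne).ne' h0
  exact ⟨w, hw, l, hl, by rw [hl0, map_zero, add_zero, add_comm]⟩

/-- If `L` is isotropic and `G(L) ⊆ P` with `dim P ≤ 2 dim L`, `L ⊆ P`, then `P = L + G(L)`. -/
theorem sup_map_eq_of_finrank_le {V : Type*} [AddCommGroup V] [Module ℝ V]
    [FiniteDimensional ℝ V] {G : GV V →ₗ[ℝ] GV V}
    (hpos : ∀ u, u ≠ 0 → 0 < pairForm V (G u) u) (hG : ∀ u, G (G u) = u)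
    {L P : Submodule ℝ (GV V)} (hL : L ≤ Ann L) (hLP : L ≤ P) (hP : P.map G ≤ P)
    (hdim : Module.finrank ℝ P ≤ Module.finrank ℝ L + Module.finrank ℝ L) :
    L ⊔ L.map G = P := by
  refine Submodule.eq_of_le_of_finrank_le (sup_le hLP ((Submodule.map_mono hLP).trans hP)) ?_
  have hinf : L ⊓ L.map G = ⊥ := by
    rw [eq_bot_iff]
    rintro _ ⟨hx, y, hy, rfl⟩
    rw [Submodule.mem_bot]
    by_contra hne
    have hy0 : y ≠ 0 := by
      rintro rfl
      exact hne (map_zero G)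
    exact (hpos y hy0).ne' (hL hx y hy)
  have h := Submodule.finrank_sup_add_finrank_inf_eq L (L.map G)
  have hinj : Function.Injective G := fun x y hxy => by rw [← hG x, hxy, hG]
  rw [hinf, finrank_bot, ← (Submodule.equivMapOfInjective G hinj L).finrank_eq] at h
  omega

/-- A functional on `E` factors, on a subspace `S`, through any linear map injective on `S`. -/
theorem exists_dual_comp_eq_on {k E F : Type*} [Field k] [AddCommGroup E] [Module k E]
    [AddCommGroup F] [Module k F] (f : E →ₗ[k] F) (S : Submodule k E)
    (hf : ∀ x ∈ S, f x = 0 → x = 0) (φ : Module.Dual k E) :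
    ∃ ξ : Module.Dual k F, ∀ y ∈ S, ξ (f y) = φ y := by
  have hker : LinearMap.ker (f ∘ₗ S.subtype) = ⊥ :=
    LinearMap.ker_eq_bot'.2 fun x hx => Subtype.ext (hf x x.2 hx)
  obtain ⟨r, hr⟩ := LinearMap.exists_leftInverse_of_injective _ hker
  refine ⟨φ ∘ₗ S.subtype ∘ₗ r, fun y hy => ?_⟩
  have : r (f y) = ⟨y, hy⟩ := LinearMap.congr_fun hr ⟨y, hy⟩
  simp [this]

/-- Lemma dual:linear: for a maximal isotropic
`K' ⊆ J₁(K) + J₂(K)` with `N' = a(K')` and `W_K = Ann(K + J₁K + J₂K + GK)`: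
`N' ⊆ Ann_V(K)`, `a` maps `W_K` into `Ann_V(K)`, the induced map
`a_{K'} : W_K → Ann_V(K)/N'` is surjective, and its kernel is a maximal isotropic
subspace of `W_K` of dimension `dim Ann_{V*}(N') − dim K`; hence the sequence
`0 → Ann_{V*}(N')/K → W_K → Ann_V(K)/N' → 0` is self-dual. -/
theorem statement17 {V : Type*} [AddCommGroup V] [Module ℝ V] [FiniteDimensional ℝ V]
    (J₁ J₂ : GV V →ₗ[ℝ] GV V) (h : IsGenKahler J₁ J₂)
    (K : Submodule ℝ (Module.Dual ℝ V))
    (h1 : ofDual K ⊔ (ofDual K).map J₁ ≤ Ann (ofDual K ⊔ (ofDual K).map J₁))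
    (h1' : ofDual K ⊔ (ofDual K).map J₂ ≤ Ann (ofDual K ⊔ (ofDual K).map J₂))
    (h2 : (ofDual K).map J₁ ⊓ VStar V = ⊥)
    (h2' : (ofDual K).map J₂ ⊓ VStar V = ⊥)
    (h3 : ((ofDual K).map J₁).map (LinearMap.fst ℝ V (Module.Dual ℝ V)) ⊓
          ((ofDual K).map J₂).map (LinearMap.fst ℝ V (Module.Dual ℝ V)) = ⊥)
    (K' : Submodule ℝ (GV V))
    (hK'le : K' ≤ (ofDual K).map J₁ ⊔ (ofDual K).map J₂)
    (hK'iso : ∀ x ∈ K', ∀ y ∈ K', pairForm V x y = 0)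
    (hK'dim : Module.finrank ℝ K' = Module.finrank ℝ K) :
    let G : GV V →ₗ[ℝ] GV V := -(J₁ ∘ₗ J₂)
    let Kv : Submodule ℝ (GV V) := ofDual K
    let W : Submodule ℝ (GV V) := Ann (Kv ⊔ Kv.map J₁ ⊔ Kv.map J₂ ⊔ Kv.map G)
    let N' : Submodule ℝ V := K'.map (LinearMap.fst ℝ V (Module.Dual ℝ V))
    let Ker : Submodule ℝ (GV V) := W ⊓ N'.comap (LinearMap.fst ℝ V (Module.Dual ℝ V))
    N' ≤ K.dualCoannihilator ∧
    (∀ x ∈ W, (x : GV V).1 ∈ K.dualCoannihilator) ∧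
    (∀ X ∈ K.dualCoannihilator, ∃ w ∈ W, (w : GV V).1 - X ∈ N') ∧
    (∀ x ∈ Ker, ∀ y ∈ Ker, pairForm V x y = 0) ∧
    (∀ x ∈ W, (∀ y ∈ Ker, pairForm V x y = 0) → x ∈ Ker) ∧
    Module.finrank ℝ Ker + Module.finrank ℝ K = Module.finrank ℝ N'.dualAnnihilator := by
  intro G Kv W N' Ker
  have hGapp : ∀ u, G u = -(J₁ (J₂ u)) := fun u => rfl
  have hG : ∀ u, G (G u) = u := fun u => by
    rw [hGapp, hGapp, map_neg, map_neg, neg_neg, ← h.comm (J₂ u), h.cx2.sq, map_neg, map_neg,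
      h.cx1.sq, neg_neg]
  have hGJ₁ : ∀ u, G (J₁ u) = J₂ u := fun u => by
    rw [hGapp, ← h.comm, h.cx1.sq, neg_neg]
  have hGJ₂ : ∀ u, G (J₂ u) = J₁ u := fun u => by
    rw [hGapp, h.cx2.sq, map_neg, neg_neg]
  have hpos : ∀ u, u ≠ 0 → 0 < pairForm V (G u) u := h.posdef
  set P : Submodule ℝ (GV V) := Kv.map J₁ ⊔ Kv.map J₂ with hP
  have hKK : Kv ≤ Ann Kv := fun x hx => (mem_ann_sup.1 (h1 (Submodule.mem_sup_left hx))).1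
  have hKP : Kv ≤ Ann P := fun x hx => mem_ann_sup.2
    ⟨(mem_ann_sup.1 (h1 (Submodule.mem_sup_left hx))).2,
      (mem_ann_sup.1 (h1' (Submodule.mem_sup_left hx))).2⟩
  have hPinj : ∀ x ∈ P, x.1 = 0 → x = 0 := by
    intro x hx hx0
    obtain ⟨y, hy, z, hz, rfl⟩ := Submodule.mem_sup.1 hx
    have hyz : y.1 = -z.1 := eq_neg_of_add_eq_zero_left hx0
    have hy0 : y.1 = 0 := by
      rw [← Submodule.mem_bot ℝ, ← h3]
      refine ⟨⟨y, hy, rfl⟩, ?_⟩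
      rw [hyz]
      exact neg_mem ⟨z, hz, rfl⟩
    have hz0 : z.1 = 0 := by rwa [hy0, zero_eq_neg] at hyz
    have hy' : y = 0 := by
      rw [← Submodule.mem_bot ℝ, ← h2]
      exact ⟨hy, y.2, Prod.ext hy0.symm rfl⟩
    have hz' : z = 0 := by
      rw [← Submodule.mem_bot ℝ, ← h2']
      exact ⟨hz, z.2, Prod.ext hz0.symm rfl⟩
    rw [hy', hz', add_zero]
  have hdimKv : Module.finrank ℝ Kv = Module.finrank ℝ K :=
    (Submodule.equivMapOfInjective _ LinearMap.inr_injective _).finrank_eq.symm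
  have hK' : K' ⊔ K'.map G = P := by
    refine sup_map_eq_of_finrank_le hpos hG hK'iso hK'le ?_ ?_
    · rw [hP, Submodule.map_sup]
      refine sup_le ?_ ?_
      · rintro _ ⟨_, ⟨x, hx, rfl⟩, rfl⟩
        rw [hGJ₁]
        exact Submodule.mem_sup_right ⟨x, hx, rfl⟩
      · rintro _ ⟨_, ⟨x, hx, rfl⟩, rfl⟩
        rw [hGJ₂]
        exact Submodule.mem_sup_left ⟨x, hx, rfl⟩
    · have hs := Submodule.finrank_add_le_finrank_add_finrank (Kv.map J₁) (Kv.map J₂)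
      have ha := Submodule.finrank_map_le J₁ Kv
      have hb := Submodule.finrank_map_le J₂ Kv
      rw [← hP] at hs
      omega
  have hW : W = Ann ((Kv ⊔ K') ⊔ (Kv ⊔ K').map G) := by
    change Ann _ = Ann _
    congr 1
    rw [Submodule.map_sup, sup_sup_sup_comm, hK', hP]
    simp only [sup_assoc, sup_comm, sup_left_comm]
  have hL : Kv ⊔ K' ≤ Ann (Kv ⊔ K') := by
    refine sup_le (fun x hx => mem_ann_sup.2 ⟨hKK hx, fun s hs => hKP hx s (hK'le hs)⟩)
      fun x hx => mem_ann_sup.2 ⟨fun s hs => ?_, hK'iso x hx⟩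
    rw [pairForm_comm]
    exact hKP hs x (hK'le hx)
  have hdecomp : ∀ u, u ∈ Ann (Kv ⊔ K') → ∃ w ∈ W, ∃ l ∈ Kv ⊔ K', w + l = u := by
    rw [hW]
    exact fun u hu => exists_add_of_mem_ann hpos hG hL hu
  have hWL : ∀ w ∈ W, ∀ l ∈ Kv ⊔ K', pairForm V w l = 0 := by
    rw [hW]
    exact fun w hw l hl => hw l (Submodule.mem_sup_left hl)
  have hKvmem : ∀ k ∈ K, ((0, k) : GV V) ∈ Kv := fun k hk => ⟨k, hk, rfl⟩
  have hKann : ∀ u : GV V, (∀ x ∈ Kv, pairForm V u x = 0) ↔ u.1 ∈ K.dualCoannihilator := by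
    intro u
    rw [Submodule.mem_dualCoannihilator]
    constructor
    · intro hu k hk
      have := hu _ (hKvmem k hk)
      rw [pairForm_apply] at this
      simpa using this
    · rintro hu _ ⟨k, hk, rfl⟩
      rw [pairForm_apply]
      simp [hu k hk]
  have hN' : N' ≤ K.dualCoannihilator := by
    rintro _ ⟨x, hx, rfl⟩
    exact (hKann x).1 fun y hy => hL (Submodule.mem_sup_right hx) y (Submodule.mem_sup_left hy)
  have hWK : ∀ x ∈ W, x.1 ∈ K.dualCoannihilator := fun x hx =>
    (hKann x).1 fun y hy => hWL x hx y (Submodule.mem_sup_left hy)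
  have hLN' : ∀ l ∈ Kv ⊔ K', l.1 ∈ N' := by
    intro l hl
    obtain ⟨_, ⟨k, hk, rfl⟩, y, hy, rfl⟩ := Submodule.mem_sup.1 hl
    exact ⟨y, hy, by simp⟩
  have hKerV : ∀ x ∈ Ker, ∃ y ∈ K', ∃ ξ ∈ N'.dualAnnihilator, x = (0, ξ) + y := by
    rintro x ⟨hx, y, hy, hyx⟩
    refine ⟨y, hy, x.2 - y.2, ?_, Prod.ext (by simpa using hyx.symm) (by simp)⟩
    rw [Submodule.mem_dualAnnihilator]
    rintro _ ⟨z, hz, rfl⟩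
    have e1 := hWL x hx z (Submodule.mem_sup_right hz)
    have e2 := hK'iso y hy z hz
    have e3 : x.1 = y.1 := hyx.symm
    rw [pairForm_apply] at e1 e2
    rw [e3] at e1
    simp only [LinearMap.sub_apply, LinearMap.fst_apply]
    linarith
  have hann : ∀ ξ ∈ N'.dualAnnihilator, ∀ y ∈ K', ξ y.1 = 0 := fun ξ hξ y hy =>
    (Submodule.mem_dualAnnihilator ξ).1 hξ _ ⟨y, hy, rfl⟩
  have hVann : ∀ ξ ∈ N'.dualAnnihilator, ((0, ξ) : GV V) ∈ Ann (Kv ⊔ K') := by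
    intro ξ hξ
    refine mem_ann_sup.2 ⟨(hKann _).2 (zero_mem _), fun y hy => ?_⟩
    rw [pairForm_apply]
    simp [hann ξ hξ y hy]
  have hVKer : ∀ ξ ∈ N'.dualAnnihilator, ∃ w ∈ Ker, ∃ l ∈ Kv ⊔ K', w + l = (0, ξ) := by
    intro ξ hξ
    obtain ⟨w, hw, l, hl, hwl⟩ := hdecomp _ (hVann ξ hξ)
    refine ⟨w, ⟨hw, ?_⟩, l, hl, hwl⟩
    have : w.1 = -l.1 := eq_neg_of_add_eq_zero_left (congrArg Prod.fst hwl)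
    change w.1 ∈ N'
    rw [this]
    exact neg_mem (hLN' l hl)
  refine ⟨hN', hWK, ?_, ?_, ?_, ?_⟩
  · intro X hX
    obtain ⟨ξ, hξ⟩ := exists_dual_comp_eq_on (LinearMap.fst ℝ V (Module.Dual ℝ V)) K'
      (fun x hx => hPinj x (hK'le hx))
      (-(Module.Dual.eval ℝ V X ∘ₗ LinearMap.snd ℝ V (Module.Dual ℝ V)))
    replace hξ : ∀ y ∈ K', ξ y.1 = -(y.2 X) := hξ
    have hu : ((X, ξ) : GV V) ∈ Ann (Kv ⊔ K') := by
      refine mem_ann_sup.2 ⟨(hKann _).2 hX, fun y hy => ?_⟩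
      rw [pairForm_apply]
      simp [hξ y hy]
    obtain ⟨w, hw, l, hl, hwl⟩ := hdecomp _ hu
    refine ⟨w, hw, ?_⟩
    have : w.1 + l.1 = X := congrArg Prod.fst hwl
    rw [← this, sub_add_cancel_left]
    exact neg_mem (hLN' l hl)
  · intro x hx y hy
    obtain ⟨k, hk, ξ, hξ, rfl⟩ := hKerV x hx
    obtain ⟨l, hl, η, hη, rfl⟩ := hKerV y hy
    have e1 := hWL _ hx.1 l (Submodule.mem_sup_right hl)
    rw [map_add, e1, add_zero, pairForm_apply]
    simp [hann η hη k hk]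
  · intro x hx hxK
    refine ⟨hx, ?_⟩
    change x.1 ∈ N'
    rw [← Subspace.dualAnnihilator_dualCoannihilator_eq (W := N'),
      Submodule.mem_dualCoannihilator]
    intro ξ hξ
    obtain ⟨w, hw, l, hl, hwl⟩ := hVKer ξ hξ
    have e : pairForm V x (0, ξ) = 0 := by
      rw [← hwl, map_add, hxK w hw, hWL x hx l hl, add_zero]
    rw [pairForm_apply] at e
    simpa using e
  · have hKvA : Kv ≤ ofDual N'.dualAnnihilator := Submodule.map_mono fun k hk => by
      rw [Submodule.mem_dualAnnihilator]
      exact fun X hX => (Submodule.mem_dualCoannihilator X).1 (hN' hX) k hk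
    have hsup : ofDual N'.dualAnnihilator ⊔ K' = Ker ⊔ (Kv ⊔ K') := by
      apply le_antisymm
      · refine sup_le ?_ (le_sup_of_le_right le_sup_right)
        rintro _ ⟨ξ, hξ, rfl⟩
        obtain ⟨w, hw, l, hl, hwl⟩ := hVKer ξ hξ
        exact Submodule.mem_sup.2 ⟨w, hw, l, hl, hwl⟩
      · refine sup_le (fun x hx => ?_) (sup_le_sup_right hKvA K')
        obtain ⟨k, hk, ξ, hξ, rfl⟩ := hKerV x hx
        exact Submodule.add_mem_sup ⟨ξ, hξ, rfl⟩ hk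
    have hAK' : ofDual N'.dualAnnihilator ⊓ K' = ⊥ := by
      rw [eq_bot_iff]
      rintro _ ⟨⟨ξ, -, rfl⟩, hx⟩
      exact (Submodule.mem_bot ℝ).2 (hPinj _ (hK'le hx) rfl)
    have hKK' : Kv ⊓ K' = ⊥ := eq_bot_iff.2 ((inf_le_inf_right K' hKvA).trans hAK'.le)
    have hKerL : Ker ⊓ (Kv ⊔ K') = ⊥ := by
      rw [eq_bot_iff]
      rintro x ⟨⟨hx, -⟩, hl⟩
      rw [Submodule.mem_bot]
      by_contra hne
      rw [hW] at hx
      have hGx := hx (G x) (Submodule.mem_sup_right (Submodule.mem_map_of_mem hl))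
      rw [pairForm_comm] at hGx
      exact (hpos x hne).ne' hGx
    have d1 := Submodule.finrank_sup_add_finrank_inf_eq (ofDual N'.dualAnnihilator) K'
    have d2 := Submodule.finrank_sup_add_finrank_inf_eq Ker (Kv ⊔ K')
    have d3 := Submodule.finrank_sup_add_finrank_inf_eq Kv K'
    have d4 : Module.finrank ℝ (ofDual N'.dualAnnihilator) =
        Module.finrank ℝ N'.dualAnnihilator :=
      (Submodule.equivMapOfInjective _ LinearMap.inr_injective _).finrank_eq.symm
    rw [hAK', finrank_bot] at d1
    rw [hKerL, finrank_bot] at d2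
    rw [hKK', finrank_bot] at d3
    rw [hsup] at d1
    omega
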